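/- Let A be an Artin algebra and D ⊆ mod A a subcategory such that D = add(D) and Ω(D) ⊆ D. Then for every X ∈ mod A one has φ(X) ≤ φ_[D](X) + φdim(D). -/

import Mathlib

/-!
Common framework for formalizing "On Lat-Igusa-Todorov algebras" (Barrios–Mata).

For a ring `S`, `FGMod S` is the "category" of finitely generated (left) `S`-modules;
for an Artin algebra `A`, the category `mod A` of finitely generated *right*
`A`-modules is `FGMod Aᵐᵒᵖ`.
-/

universe u v

open Function

namespace LIT

/-- The `η` invariant from Fitting's Lemma: for an endomorphism `L` of an abelian
group `G` and a subgroup `X`, the least `k` such that for all `m ≥ k` the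
restriction of `L` to `L^m(X)` is a monomorphism `L^m(X) → L^{m+1}(X)`. -/
noncomputable def eta {G : Type v} [AddCommGroup G] (L : AddMonoid.End G)
    (X : AddSubgroup G) : ℕ :=
  sInf {k : ℕ | ∀ m : ℕ, k ≤ m → Set.InjOn L (X.map (L ^ m) : Set G)}

/-- Bundled finitely generated `S`-modules. -/
structure FGMod (S : Type u) [Ring S] : Type (u + 1) where
  carrier : Type u
  [isAddCommGroup : AddCommGroup carrier]
  [isModule : Module S carrier]
  [isFinite : Module.Finite S carrier]

attribute [instance] FGMod.isAddCommGroup FGMod.isModule FGMod.isFinite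

/-- The regular module `S` over itself. -/
def FGMod.regular (S : Type u) [Ring S] : FGMod S := ⟨S⟩

/-- A ring is finitely generated as a right module over itself. -/
instance (A : Type u) [Ring A] : Module.Finite Aᵐᵒᵖ A :=
  Module.Finite.of_surjective
    ({ toFun := MulOpposite.unop
       map_add' := fun _ _ => rfl
       map_smul' := fun _ _ => rfl } : Aᵐᵒᵖ →ₗ[Aᵐᵒᵖ] A)
    (fun x => ⟨MulOpposite.op x, rfl⟩)

namespace FGMod

variable {S : Type u} [Ring S]

/-- Projectivity of a module. -/
def IsProj (M : FGMod S) : Prop := Module.Projective S M.carrier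

/-- Direct sum (product) of two modules. -/
def prodMod (M N : FGMod S) : FGMod S := ⟨M.carrier × N.carrier⟩

/-- Finite direct sums. -/
def dsum {n : ℕ} (f : Fin n → FGMod S) : FGMod S := ⟨∀ i, (f i).carrier⟩

/-- `N` is a direct summand of `M`. -/
def IsSummand (N M : FGMod S) : Prop :=
  ∃ N' : FGMod S, Nonempty (M.carrier ≃ₗ[S] N.carrier × N'.carrier)

/-- `addOf C` is `add C`: all direct summands of finite direct sums of modules of `C`. -/
def addOf (C : Set (FGMod S)) : Set (FGMod S) :=
  {N | ∃ (n : ℕ) (f : Fin n → FGMod S), (∀ i, f i ∈ C) ∧ IsSummand N (dsum f)}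

/-- `f : P → M` is a projective cover: `P` projective, `f` surjective with superfluous kernel. -/
def IsProjCover {P M : FGMod S} (f : P.carrier →ₗ[S] M.carrier) : Prop :=
  P.IsProj ∧ Surjective f ∧
    ∀ N : Submodule S P.carrier, N ⊔ LinearMap.ker f = ⊤ → N = ⊤

/-- `N` is (isomorphic to) the syzygy `Ω(M)`, i.e. the kernel of a projective cover of `M`. -/
def IsSyzygyOf (N M : FGMod S) : Prop :=
  ∃ (P : FGMod S) (f : P.carrier →ₗ[S] M.carrier),
    IsProjCover f ∧ Nonempty (N.carrier ≃ₗ[S] LinearMap.ker f)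

/-- The syzygy `Ω(M)` of `M` (a choice of it; over an Artin algebra it exists and is
unique up to isomorphism). -/
noncomputable def syz (M : FGMod S) : FGMod S :=
  letI := Classical.propDecidable (∃ N, IsSyzygyOf N M)
  if h : ∃ N, IsSyzygyOf N M then h.choose else M

/-- `SES X Y Z` : there is a short exact sequence `0 → X → Y → Z → 0`. -/
def SES (X Y Z : FGMod S) : Prop :=
  ∃ (f : X.carrier →ₗ[S] Y.carrier) (g : Y.carrier →ₗ[S] Z.carrier),
    Injective f ∧ Surjective g ∧ LinearMap.range f = LinearMap.ker g

/-- Projective dimension, via vanishing of syzygies. -/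
noncomputable def pdim (M : FGMod S) : ℕ∞ :=
  sInf ((↑) '' {n : ℕ | (syz^[n] M).IsProj})

end FGMod

open FGMod

variable {S : Type u} [Ring S]

/-- The finitistic dimension of a class of modules: the supremum of the projective
dimensions of its modules of finite projective dimension. -/
noncomputable def findim (C : Set (FGMod S)) : ℕ∞ :=
  ⨆ M ∈ {M ∈ C | pdim M ≠ ⊤}, pdim M

/-- The global dimension of a class of modules. -/
noncomputable def gldim (C : Set (FGMod S)) : ℕ∞ :=
  ⨆ M ∈ C, pdim M

/-- The defining relations of `K₀`: `[M] - [M'] - [M'']` for `M ≅ M' ⊕ M''`, and `[P]`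
for `P` projective. -/
def K0Rels (S : Type u) [Ring S] : AddSubgroup (FreeAbelianGroup (FGMod S)) :=
  AddSubgroup.closure
    ({x | ∃ M M' M'' : FGMod S,
        Nonempty (M.carrier ≃ₗ[S] M'.carrier × M''.carrier) ∧
        x = FreeAbelianGroup.of M - FreeAbelianGroup.of M' - FreeAbelianGroup.of M''} ∪
      {x | ∃ P : FGMod S, P.IsProj ∧ x = FreeAbelianGroup.of P})

/-- `K₀(A)`: the free abelian group on the modules modulo the relations above. -/
abbrev K0 (S : Type u) [Ring S] : Type (u + 1) :=
  FreeAbelianGroup (FGMod S) ⧸ K0Rels S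

/-- The class `[M]` of a module in `K₀`. -/
def toK0 (M : FGMod S) : K0 S := QuotientAddGroup.mk (FreeAbelianGroup.of M)

/-- `⟨C⟩`: the subgroup of `K₀` generated by the classes of direct summands of
modules of `C`. -/
def grpOf (C : Set (FGMod S)) : AddSubgroup (K0 S) :=
  AddSubgroup.closure {x | ∃ N M : FGMod S, M ∈ C ∧ IsSummand N M ∧ x = toK0 N}

/-- `K_D = K₀/⟨D⟩`. -/
abbrev KD (D : Set (FGMod S)) : Type (u + 1) := K0 S ⧸ grpOf D

/-- The class of a module in `K_D`. -/
def toKD (D : Set (FGMod S)) (M : FGMod S) : KD D :=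
  QuotientAddGroup.mk (toK0 M)

/-- `L` is the endomorphism `Ω̄` of `K₀` induced by the syzygy operator (it is unique). -/
def IsSyzEnd (L : AddMonoid.End (K0 S)) : Prop :=
  ∀ M : FGMod S, L (toK0 M) = toK0 (syz M)

/-- `L` is the endomorphism `Ω̄_D` of `K_D` induced by the syzygy operator. -/
def IsSyzEndD (D : Set (FGMod S)) (L : AddMonoid.End (KD D)) : Prop :=
  ∀ M : FGMod S, L (toKD D M) = toKD D (syz M)

/-- The Igusa–Todorov function `φ`, relative to the induced endomorphism `L = Ω̄` of `K₀`. -/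
noncomputable def phi (L : AddMonoid.End (K0 S)) (M : FGMod S) : ℕ :=
  eta L (grpOf {M})

/-- `φ`-dimension of a class of modules. -/
noncomputable def phidim (L : AddMonoid.End (K0 S)) (C : Set (FGMod S)) : ℕ∞ :=
  ⨆ M ∈ C, (phi L M : ℕ∞)

/-- The generalized Igusa–Todorov function `φ_[D]`, relative to `L = Ω̄_D`. -/
noncomputable def phiD (D : Set (FGMod S)) (L : AddMonoid.End (KD D)) (M : FGMod S) : ℕ :=
  eta L ((grpOf {M}).map (QuotientAddGroup.mk' (grpOf D)))

/-- The generalized Igusa–Todorov function `ψ_[D]`. -/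
noncomputable def psiD (D : Set (FGMod S)) (L : AddMonoid.End (KD D)) (M : FGMod S) : ℕ∞ :=
  (phiD D L M : ℕ∞) + findim (addOf {syz^[phiD D L M] M})

/-- `D` is a `0`-Igusa–Todorov subcategory: `D = add D`, `Ω(D) ⊆ D` and `φdim D = 0`. -/
def IsZeroIT (L : AddMonoid.End (K0 S)) (D : Set (FGMod S)) : Prop :=
  D = addOf D ∧ (∀ M ∈ D, syz M ∈ D) ∧ phidim L D = 0

/-- The class `C` is `(n,V,D)`-Lat-Igusa-Todorov: every `M ∈ C` admits an exact sequence
`0 → V₁ ⊕ D₁ → V₀ ⊕ D₀ → Ωⁿ(M) → 0` with `V₁, V₀ ∈ add V` and `D₁, D₀ ∈ D`. -/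
def IsLITClass (n : ℕ) (V : FGMod S) (D : Set (FGMod S)) (C : Set (FGMod S)) : Prop :=
  ∀ M ∈ C, ∃ V1 V0 D1 D0 : FGMod S,
    V1 ∈ addOf {V} ∧ V0 ∈ addOf {V} ∧ D1 ∈ D ∧ D0 ∈ D ∧
    SES (prodMod V1 D1) (prodMod V0 D0) (syz^[n] M)

/-- `[C]_D`: the image of `⟨C⟩` in `K_D`, i.e. `(⟨C⟩ + ⟨D⟩)/⟨D⟩`. -/
def classGrpD (D C : Set (FGMod S)) : AddSubgroup (KD D) :=
  (grpOf C).map (QuotientAddGroup.mk' (grpOf D))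

/-- `C` is `D`-syzygy finite: `[Ω^k(C)]_D` is finitely generated for some `k`. -/
def DSyzFinite (D C : Set (FGMod S)) : Prop :=
  ∃ k : ℕ, (classGrpD D ((fun M => syz^[k] M) '' C)).FG

/-- The algebra is `n`-LIT: there are a `0`-Igusa–Todorov subcategory `D` and a module `V`
such that `mod A` is `(n,V,D)`-LIT. -/
def IsNLITAlgebra (L : AddMonoid.End (K0 S)) (n : ℕ) : Prop :=
  ∃ (V : FGMod S) (D : Set (FGMod S)), IsZeroIT L D ∧ IsLITClass n V D Set.univ

/-- The algebra is LIT: it is `n`-LIT for some `n`. -/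
def IsLITAlgebra (L : AddMonoid.End (K0 S)) : Prop :=
  ∃ n : ℕ, IsNLITAlgebra L n


namespace FGMod

section Summands

theorem IsSummand.of_retract [IsNoetherianRing S] {N M : FGMod S}
    (j : N.carrier →ₗ[S] M.carrier) (p : M.carrier →ₗ[S] N.carrier)
    (h : ∀ x, p (j x) = x) : IsSummand N M := by
  refine ⟨⟨LinearMap.ker p⟩, ⟨LinearEquiv.ofBijective
    (p.prod ((LinearMap.id - j ∘ₗ p).codRestrict (LinearMap.ker p)
      (fun x => by simp [h]))) ⟨?_, ?_⟩⟩⟩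
  · refine (injective_iff_map_eq_zero _).2 fun x hx => ?_
    have h1 : p x = 0 := congrArg Prod.fst hx
    have h2 : x - j (p x) = 0 := congrArg Subtype.val (congrArg Prod.snd hx)
    simpa [h1] using h2
  · rintro ⟨n, k, hk⟩
    have hk' : p k = 0 := hk
    refine ⟨j n + k, Prod.ext ?_ (Subtype.ext ?_)⟩
    · change p (j n + k) = n
      simp [h, hk']
    · change (j n + k) - j (p (j n + k)) = k
      simp [h, hk']

theorem IsSummand.exists_retract {N M : FGMod S} (h : IsSummand N M) :
    ∃ (j : N.carrier →ₗ[S] M.carrier) (p : M.carrier →ₗ[S] N.carrier),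
      ∀ x, p (j x) = x := by
  obtain ⟨N', ⟨e⟩⟩ := h
  exact ⟨e.symm.toLinearMap ∘ₗ LinearMap.inl S _ _, LinearMap.fst S _ _ ∘ₗ e.toLinearMap,
    fun x => by simp⟩

theorem IsSummand.trans [IsNoetherianRing S] {N M K : FGMod S}
    (h : IsSummand N M) (h' : IsSummand M K) : IsSummand N K := by
  obtain ⟨j, p, hp⟩ := h.exists_retract
  obtain ⟨j', p', hp'⟩ := h'.exists_retract
  exact .of_retract (j' ∘ₗ j) (p ∘ₗ p') fun x => by simp [hp, hp']

theorem IsSummand.of_equiv_left {M M' M'' : FGMod S}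
    (e : M.carrier ≃ₗ[S] M'.carrier × M''.carrier) : IsSummand M' M :=
  ⟨M'', ⟨e⟩⟩

theorem IsSummand.of_equiv_right {M M' M'' : FGMod S}
    (e : M.carrier ≃ₗ[S] M'.carrier × M''.carrier) : IsSummand M'' M :=
  ⟨M', ⟨e.trans (LinearEquiv.prodComm S _ _)⟩⟩

end Summands

/-- Indecomposability, in terms of complementary submodules. -/
def IsIndec (M : FGMod S) : Prop :=
  Nontrivial M.carrier ∧ ∀ p q : Submodule S M.carrier, IsCompl p q → p = ⊥ ∨ q = ⊥

theorem IsIndec.isUnit_or_isNilpotent [IsArtinianRing S] {M : FGMod S} (hM : M.IsIndec)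
    (f : Module.End S M.carrier) : IsUnit f ∨ IsNilpotent f := by
  obtain ⟨n, hn, hn1⟩ :=
    (f.eventually_isCompl_ker_pow_range_pow.and (Filter.eventually_ge_atTop 1)).exists
  rcases hM.2 _ _ hn with h | h
  · left
    have hinj : Injective (f ^ n) := LinearMap.ker_eq_bot.1 h
    have hu : IsUnit (f ^ n) :=
      (Module.End.isUnit_iff _).2 (IsArtinian.bijective_of_injective_endomorphism _ hinj)
    exact (isUnit_pow_iff (by lia)).1 hu
  · exact .inr ⟨n, LinearMap.range_eq_bot.1 h⟩

theorem IsIndec.isUnit_or_isUnit [IsArtinianRing S] {M : FGMod S} (hM : M.IsIndec)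
    {f g : Module.End S M.carrier} (h : f + g = 1) : IsUnit f ∨ IsUnit g := by
  refine (hM.isUnit_or_isNilpotent f).imp_right fun hf => ?_
  rw [eq_sub_of_add_eq' h]
  exact hf.isUnit_one_sub

/-- An endomorphism of `N` factoring through `M` and invertible exhibits `N` as a summand. -/
theorem IsSummand.of_isUnit_comp [IsNoetherianRing S] {N M : FGMod S}
    (j : N.carrier →ₗ[S] M.carrier) (p : M.carrier →ₗ[S] N.carrier)
    (h : IsUnit (p ∘ₗ j : Module.End S N.carrier)) : IsSummand N M := by
  obtain ⟨g, hg⟩ := h.exists_left_inv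
  exact .of_retract j (g ∘ₗ p) fun x => LinearMap.congr_fun hg x

/-- The exchange property of indecomposable modules. -/
theorem IsIndec.isSummand_or [IsArtinianRing S] {N M A B : FGMod S} (hN : N.IsIndec)
    (h : IsSummand N M) (e : M.carrier ≃ₗ[S] A.carrier × B.carrier) :
    IsSummand N A ∨ IsSummand N B := by
  obtain ⟨j, p, hp⟩ := h.exists_retract
  let p' := p ∘ₗ e.symm.toLinearMap
  let j' := e.toLinearMap ∘ₗ j
  have key : ((p' ∘ₗ LinearMap.inl S _ _) ∘ₗ (LinearMap.fst S _ _ ∘ₗ j') : Module.End S N.carrier)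
      + (p' ∘ₗ LinearMap.inr S _ _) ∘ₗ (LinearMap.snd S _ _ ∘ₗ j') = 1 := by
    ext x
    simp only [LinearMap.add_apply, LinearMap.comp_apply, ← map_add, LinearMap.inl_apply,
      LinearMap.inr_apply, LinearMap.fst_apply, LinearMap.snd_apply, Prod.mk_add_mk, add_zero,
      zero_add]
    simp [p', j', hp]
  exact (hN.isUnit_or_isUnit key).imp (IsSummand.of_isUnit_comp _ _) (IsSummand.of_isUnit_comp _ _)

theorem exists_decomposition [IsArtinianRing S] {M : FGMod S} (hM : Nontrivial M.carrier)
    (hM' : ¬ M.IsIndec) : ∃ A B : FGMod S, Nonempty (M.carrier ≃ₗ[S] A.carrier × B.carrier) ∧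
      Module.length S A.carrier < Module.length S M.carrier ∧
      Module.length S B.carrier < Module.length S M.carrier := by
  simp only [IsIndec, not_and, not_forall, not_or] at hM'
  obtain ⟨p, q, hpq, hp, hq⟩ := hM' hM
  refine ⟨⟨p⟩, ⟨q⟩, ⟨(Submodule.prodEquivOfIsCompl p q hpq).symm⟩,
    Submodule.length_lt ?_, Submodule.length_lt ?_⟩
  · rintro rfl
    exact hq (by simpa using hpq.disjoint)
  · rintro rfl
    exact hp (by simpa using hpq.disjoint)

/-- Induction along direct sum decompositions. -/
theorem decomposition_induction [IsArtinianRing S] {C : FGMod S → Prop}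
    (zero : ∀ M : FGMod S, Subsingleton M.carrier → C M)
    (indec : ∀ M : FGMod S, M.IsIndec → C M)
    (sum : ∀ M A B : FGMod S, (M.carrier ≃ₗ[S] A.carrier × B.carrier) → C A → C B → C M)
    (M : FGMod S) : C M := by
  induction hl : Module.length S M.carrier using WellFoundedLT.induction generalizing M with
  | ind l ih =>
    subst hl
    rcases subsingleton_or_nontrivial M.carrier with h | h
    · exact zero M h
    by_cases h' : M.IsIndec
    · exact indec M h'
    obtain ⟨A, B, ⟨e⟩, hA, hB⟩ := exists_decomposition h h'
    exact sum M A B e (ih _ hA A rfl) (ih _ hB B rfl)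

end FGMod

section GrothendieckGroup

theorem toK0_eq_add {M M' M'' : FGMod S} (e : M.carrier ≃ₗ[S] M'.carrier × M''.carrier) :
    toK0 M = toK0 M' + toK0 M'' := by
  have h : (QuotientAddGroup.mk (FreeAbelianGroup.of M - FreeAbelianGroup.of M' -
      FreeAbelianGroup.of M'') : K0 S) = 0 :=
    (QuotientAddGroup.eq_zero_iff _).2
      (AddSubgroup.subset_closure (.inl ⟨M, M', M'', ⟨e⟩, rfl⟩))
  have h' : toK0 M - toK0 M' - toK0 M'' = 0 := h
  rw [sub_sub, sub_eq_zero] at h'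
  exact h'

theorem toK0_of_subsingleton {M : FGMod S} (h : Subsingleton M.carrier) : toK0 M = 0 :=
  (QuotientAddGroup.eq_zero_iff _).2
    (AddSubgroup.subset_closure (.inr ⟨M, Module.Projective.of_free, rfl⟩))

theorem addHom_ext_toK0 {G : Type*} [AddCommGroup G] {f g : K0 S →+ G}
    (h : ∀ M, f (toK0 M) = g (toK0 M)) : f = g :=
  QuotientAddGroup.addMonoidHom_ext _ ((FreeAbelianGroup.lift_ext _ _ h))

theorem toK0_mem_grpOf_singleton {N M : FGMod S} (h : IsSummand N M) :
    toK0 N ∈ grpOf ({M} : Set (FGMod S)) :=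
  AddSubgroup.subset_closure ⟨N, M, rfl, h, rfl⟩

theorem grpOf_singleton_le {M : FGMod S} {H : AddSubgroup (K0 S)} :
    grpOf {M} ≤ H ↔ ∀ N, IsSummand N M → toK0 N ∈ H := by
  refine ⟨fun h N hN => h (toK0_mem_grpOf_singleton hN), fun h => ?_⟩
  refine (AddSubgroup.closure_le _).2 ?_
  rintro _ ⟨N, _, rfl, hN, rfl⟩
  exact h N hN

theorem grpOf_singleton_mono [IsNoetherianRing S] {N M : FGMod S} (h : IsSummand N M) :
    grpOf {N} ≤ grpOf {M} :=
  grpOf_singleton_le.2 fun _ hK => toK0_mem_grpOf_singleton (hK.trans h)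

theorem toK0_mem_of_indec_summands [IsArtinianRing S] (H : AddSubgroup (K0 S)) (M : FGMod S)
    (h : ∀ N : FGMod S, N.IsIndec → IsSummand N M → toK0 N ∈ H) : toK0 M ∈ H := by
  induction M using decomposition_induction with
  | zero M hM => exact toK0_of_subsingleton hM ▸ H.zero_mem
  | indec M hM => exact h M hM (.of_retract LinearMap.id LinearMap.id fun _ => rfl)
  | sum M A B e hA hB =>
    rw [toK0_eq_add e]
    exact H.add_mem (hA fun N hN hs => h N hN (hs.trans (.of_equiv_left e)))
      (hB fun N hN hs => h N hN (hs.trans (.of_equiv_right e)))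

theorem grpOf_singleton_fg [IsArtinianRing S] (M : FGMod S) :
    (grpOf ({M} : Set (FGMod S))).FG := by
  induction M using decomposition_induction with
  | zero M hM =>
    have : grpOf {M} = ⊥ := le_bot_iff.1 <| grpOf_singleton_le.2 fun N hN => by
      obtain ⟨j, p, hp⟩ := hN.exists_retract
      exact toK0_of_subsingleton (LeftInverse.injective hp).subsingleton
    exact this ▸ AddSubgroup.FG.bot
  | indec M hM =>
    have : grpOf {M} = AddSubgroup.closure (({toK0 M} : Finset (K0 S)) : Set (K0 S)) := by
      refine le_antisymm ?_ ?_
      · refine grpOf_singleton_le.2 fun N hN => toK0_mem_of_indec_summands _ _ fun K hK hKN => ?_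
        obtain ⟨N', ⟨e⟩⟩ := hKN.trans hN
        have hN' : Subsingleton N'.carrier := by
          have hc := LinearMap.isCompl_range_inl_inr (R := S) (M := K.carrier) (M₂ := N'.carrier)
          rcases hM.2 _ _ (hc.map (Submodule.orderIsoMapComap e.symm)) with h | h
          · have := hK.1
            obtain ⟨x, hx⟩ := exists_ne (0 : K.carrier)
            have hmem : e.symm (x, 0) ∈ Submodule.orderIsoMapComap e.symm
              (LinearMap.range (LinearMap.inl S K.carrier N'.carrier)) :=
                Submodule.mem_map_of_mem ⟨x, rfl⟩
            rw [h, Submodule.mem_bot] at hmem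
            exact absurd (by simpa using hmem) hx
          · refine subsingleton_of_forall_eq 0 fun x => ?_
            have hmem : e.symm (0, x) ∈ Submodule.orderIsoMapComap e.symm
              (LinearMap.range (LinearMap.inr S K.carrier N'.carrier)) :=
                Submodule.mem_map_of_mem ⟨x, rfl⟩
            rw [h, Submodule.mem_bot] at hmem
            simpa using hmem
        have : toK0 K = toK0 M := by
          rw [toK0_eq_add e, toK0_of_subsingleton hN', add_zero]
        rw [this]
        exact AddSubgroup.subset_closure (by simp)
      · refine (AddSubgroup.closure_le _).2 ?_
        simpa using toK0_mem_grpOf_singleton (M := M)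
          (.of_retract LinearMap.id LinearMap.id fun _ => rfl)
    exact ⟨_, this.symm⟩
  | sum M A B e hA hB =>
    have : grpOf {M} = grpOf {A} ⊔ grpOf {B} := by
      refine le_antisymm ?_ (sup_le (grpOf_singleton_mono (.of_equiv_left e))
        (grpOf_singleton_mono (.of_equiv_right e)))
      refine grpOf_singleton_le.2 fun N hN => toK0_mem_of_indec_summands _ _ fun K hK hKN => ?_
      rcases hK.isSummand_or (hKN.trans hN) e with h | h
      · exact AddSubgroup.mem_sup_left (toK0_mem_grpOf_singleton h)
      · exact AddSubgroup.mem_sup_right (toK0_mem_grpOf_singleton h)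
    exact this ▸ hA.sup hB

/-- `D = add D` is closed under binary direct sums. -/
theorem prodMod_mem [IsNoetherianRing S] {D : Set (FGMod S)} (hadd : D = addOf D) {M N : FGMod S}
    (hM : M ∈ D) (hN : N ∈ D) : prodMod M N ∈ D := by
  rw [hadd]
  let f : Fin 2 → FGMod S := fun i => if i = 0 then M else N
  let e : (∀ i, (f i).carrier) ≃ₗ[S] M.carrier × N.carrier :=
    LinearEquiv.piFinTwo S fun i => (f i).carrier
  exact ⟨2, f, fun i => by fin_cases i <;> assumption,
    .of_retract (N := prodMod M N) (M := dsum f) e.symm.toLinearMap e.toLinearMap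
      e.apply_symm_apply⟩

theorem zero_mem_of_eq_addOf [IsNoetherianRing S] {D : Set (FGMod S)} (hadd : D = addOf D) :
    (⟨PUnit⟩ : FGMod S) ∈ D := by
  rw [hadd]
  exact ⟨0, Fin.elim0, fun i => i.elim0, .of_retract 0 0 fun _ => rfl⟩

/-- Every element of `⟨D⟩` lies in `⟨M⟩` for a single module `M ∈ D`. -/
theorem exists_mem_grpOf_singleton [IsNoetherianRing S] {D : Set (FGMod S)} (hadd : D = addOf D)
    {y : K0 S} (hy : y ∈ grpOf D) : ∃ M ∈ D, y ∈ grpOf ({M} : Set (FGMod S)) := by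
  induction hy using AddSubgroup.closure_induction with
  | mem x hx =>
    obtain ⟨N, M, hM, hN, rfl⟩ := hx
    exact ⟨M, hM, toK0_mem_grpOf_singleton hN⟩
  | zero => exact ⟨_, zero_mem_of_eq_addOf hadd, zero_mem _⟩
  | add x y _ _ hx hy =>
    obtain ⟨M, hM, hx⟩ := hx
    obtain ⟨N, hN, hy⟩ := hy
    let e : (prodMod M N).carrier ≃ₗ[S] M.carrier × N.carrier := LinearEquiv.refl S _
    exact ⟨_, prodMod_mem hadd hM hN,
      add_mem (grpOf_singleton_mono (.of_equiv_left e) hx)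
        (grpOf_singleton_mono (.of_equiv_right e) hy)⟩
  | neg x _ hx =>
    obtain ⟨M, hM, hx⟩ := hx
    exact ⟨M, hM, neg_mem hx⟩

end GrothendieckGroup

section Fitting

variable {G : Type v} [AddCommGroup G]

theorem injOn_map_pow_iff (L : AddMonoid.End G) (X : AddSubgroup G) (m : ℕ) :
    Set.InjOn L (X.map (L ^ m) : Set G) ↔ ∀ x ∈ X, (L ^ (m + 1)) x = 0 → (L ^ m) x = 0 := by
  have hpow (x : G) : (L ^ (m + 1)) x = L ((L ^ m) x) := by rw [pow_succ']; rfl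
  constructor
  · intro h x hx h0
    exact h ⟨x, hx, rfl⟩ (zero_mem (X.map (L ^ m))) ((hpow x).symm.trans (h0.trans (map_zero L).symm))
  · rintro h _ ⟨x, hx, rfl⟩ _ ⟨y, hy, rfl⟩ hxy
    have h1 : (L ^ (m + 1)) (x - y) = 0 := by
      rw [map_sub, hpow, hpow, sub_eq_zero]
      exact hxy
    have h2 := h _ (sub_mem hx hy) h1
    rw [map_sub, sub_eq_zero] at h2
    exact h2

theorem eta_le {L : AddMonoid.End G} {X : AddSubgroup G} {k : ℕ}
    (h : ∀ m, k ≤ m → ∀ x ∈ X, (L ^ (m + 1)) x = 0 → (L ^ m) x = 0) : eta L X ≤ k :=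
  Nat.sInf_le fun m hm => (injOn_map_pow_iff L X m).2 (h m hm)

/-- Fitting's Lemma for finitely generated subgroups. -/
theorem exists_forall_injOn (L : AddMonoid.End G) {X : AddSubgroup G} (hX : X.FG) :
    ∃ k : ℕ, ∀ m : ℕ, k ≤ m → Set.InjOn L (X.map (L ^ m) : Set G) := by
  have : IsNoetherian ℤ (AddSubgroup.toIntSubmodule X) :=
    isNoetherian_of_fg_of_noetherian _ ((Submodule.fg_iff_addSubgroup_fg _).2 hX)
  let K : ℕ →o Submodule ℤ (AddSubgroup.toIntSubmodule X) :=
    { toFun := fun n => LinearMap.ker ((L ^ n : AddMonoid.End G).toIntLinearMap ∘ₗ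
        (AddSubgroup.toIntSubmodule X).subtype)
      monotone' := monotone_nat_of_le_succ fun n x hx => by
        have hx' : (L ^ n) (x : G) = 0 := hx
        change (L ^ (n + 1)) (x : G) = 0
        rw [pow_succ']
        exact (congrArg L hx').trans (map_zero L) }
  obtain ⟨k, hk⟩ := monotone_stabilizes_iff_noetherian.2 this K
  refine ⟨k, fun m hm => (injOn_map_pow_iff L X m).2 fun x hx h0 => ?_⟩
  have hmem : (⟨x, hx⟩ : AddSubgroup.toIntSubmodule X) ∈ K (m + 1) := h0
  rw [← hk (m + 1) (by lia), hk m hm] at hmem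
  exact hmem

theorem pow_eta_eq_zero {L : AddMonoid.End G} {X : AddSubgroup G} (hX : X.FG) {m : ℕ}
    {x : G} (hx : x ∈ X) (h0 : (L ^ m) x = 0) : (L ^ eta L X) x = 0 := by
  have hη : ∀ m, eta L X ≤ m → Set.InjOn L (X.map (L ^ m) : Set G) :=
    Nat.sInf_mem (exists_forall_injOn L hX)
  rcases le_total m (eta L X) with h | h
  · rw [← Nat.sub_add_cancel h, pow_add]
    exact (congrArg (L ^ (eta L X - m)) h0).trans (map_zero (L ^ (eta L X - m)))
  · induction m, h using Nat.le_induction with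
    | base => exact h0
    | succ m hm ih => exact ih ((injOn_map_pow_iff L X m).1 (hη m hm) x hx h0)

theorem pow_eq_zero_of_eta_le {L : AddMonoid.End G} {X : AddSubgroup G} (hX : X.FG) {m n : ℕ}
    {x : G} (hx : x ∈ X) (h0 : (L ^ m) x = 0) (hn : eta L X ≤ n) : (L ^ n) x = 0 := by
  rw [← Nat.sub_add_cancel hn, pow_add]
  exact (congrArg (L ^ (n - eta L X)) (pow_eta_eq_zero hX hx h0)).trans
    (map_zero (L ^ (n - eta L X)))

theorem fg_map {H : Type*} [AddCommGroup H] (f : G →+ H) {X : AddSubgroup G} (hX : X.FG) :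
    (X.map f).FG := by
  classical
  obtain ⟨s, rfl⟩ := hX
  exact ⟨s.image f, by rw [Finset.coe_image, AddMonoidHom.map_closure]⟩

end Fitting

theorem syzEndD_pow_mk {D : Set (FGMod S)} {L : AddMonoid.End (K0 S)} (hL : IsSyzEnd L)
    {LD : AddMonoid.End (KD D)} (hLD : IsSyzEndD D LD) (n : ℕ) (x : K0 S) :
    (LD ^ n) (QuotientAddGroup.mk' (grpOf D) x) = QuotientAddGroup.mk' (grpOf D) ((L ^ n) x) := by
  have hcomm : LD.comp (QuotientAddGroup.mk' (grpOf D)) =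
      (QuotientAddGroup.mk' (grpOf D)).comp L :=
    addHom_ext_toK0 fun M =>
      (hLD M).trans (congrArg (QuotientAddGroup.mk' (grpOf D)) (hL M)).symm
  induction n with
  | zero => rfl
  | succ n ih =>
    rw [pow_succ', pow_succ']
    exact (congrArg LD ih).trans (DFunLike.congr_fun hcomm ((L ^ n) x))

/-!
STATEMENT 2 (Theorem of [BLMV]).  Let `A` be an Artin algebra and `D ⊆ mod A` with
`D = add D` and `Ω(D) ⊆ D`.  Then for every `X ∈ mod A`,
`φ(X) ≤ φ_[D](X) + φdim(D)`.
Here `L` (resp. `LD`) is the endomorphism `Ω̄` of `K₀(A)` (resp. `Ω̄_D` of `K_D(A)`)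
induced by the syzygy operator.
-/
theorem stmt_2 (R A : Type u) [CommRing R] [IsArtinianRing R] [Ring A] [Algebra R A]
    [Module.Finite R A]
    (D : Set (FGMod Aᵐᵒᵖ)) (hadd : D = addOf D) (hsyz : ∀ M ∈ D, syz M ∈ D)
    (L : AddMonoid.End (K0 Aᵐᵒᵖ)) (hL : IsSyzEnd L)
    (LD : AddMonoid.End (KD D)) (hLD : IsSyzEndD D LD)
    (X : FGMod Aᵐᵒᵖ) :
    (phi L X : ℕ∞) ≤ (phiD D LD X : ℕ∞) + phidim L D := by
  have : IsArtinianRing Aᵐᵒᵖ := .of_finite R Aᵐᵒᵖ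
  by_cases htop : phidim L D = ⊤
  · simp [htop]
  obtain ⟨d, hd⟩ := ENat.ne_top_iff_exists.1 htop
  rw [← hd]
  norm_cast
  refine eta_le fun m hm x hx h0 => ?_
  set k := phiD D LD X with hk
  have hker : (LD ^ k) (QuotientAddGroup.mk' (grpOf D) x) = 0 :=
    pow_eta_eq_zero (fg_map _ (grpOf_singleton_fg X)) (m := m + 1)
      (AddSubgroup.mem_map_of_mem _ hx) (by rw [syzEndD_pow_mk hL hLD, h0, map_zero])
  rw [syzEndD_pow_mk hL hLD] at hker
  obtain ⟨M, hM, hy⟩ := exists_mem_grpOf_singleton hadd ((QuotientAddGroup.eq_zero_iff _).1 hker)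
  have hφ : phi L M ≤ d := by
    have h : (phi L M : ℕ∞) ≤ phidim L D :=
      le_iSup₂ (f := fun M (_ : M ∈ D) => (phi L M : ℕ∞)) M hM
    rw [← hd] at h
    exact_mod_cast h
  have hpow (n : ℕ) : (L ^ n) ((L ^ k) x) = (L ^ (n + k)) x := by rw [pow_add]; rfl
  have hzero := pow_eq_zero_of_eta_le (grpOf_singleton_fg M) hy (m := m + 1 - k) (n := m - k)
    (by rw [hpow, Nat.sub_add_cancel (by lia), h0]) (hφ.trans (by lia))
  rwa [hpow, Nat.sub_add_cancel (by lia)] at hzero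
end LIT
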